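/- The cotorsion pair (P_n, P_n^⊥) in R-Mod is cogenerated by the set of n-projective modules of cardinality at most κ, where κ ≥ card(R) is infinite: a module Y satisfies Ext¹(X, Y) = 0 for every module X of projective dimension at most n if and only if Ext¹(L, Y) = 0 for every module L of projective dimension at most n with card(L) ≤ κ. -/

import Mathlib

open CategoryTheory Limits

/-- A resolution `0 → P_n → ⋯ → P_1 → P_0 → X → 0` of length at most `n` of the module `X`,
encoded as an `ℕ`-indexed exact sequence which vanishes in degrees `> n`. -/
structure ResolutionOfLength (R : Type) [Ring R] (n : ℕ) (X : ModuleCat R) where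
  P : ℕ → ModuleCat R
  d : ∀ i : ℕ, P (i + 1) ⟶ P i
  ε : P 0 ⟶ X
  surj : Function.Surjective ε
  exact₀ : Function.Exact (d 0) ε
  exact : ∀ i : ℕ, Function.Exact (d (i + 1)) (d i)
  bounded : ∀ i : ℕ, n < i → Subsingleton (P i)

/-- A module has projective dimension at most `n` if it admits a projective resolution of
length `n`. -/
def HasProjDimLE (R : Type) [Ring R] (n : ℕ) (X : ModuleCat R) : Prop :=
  ∃ res : ResolutionOfLength R n X, ∀ i : ℕ, Module.Projective R (res.P i)

/-- `Ext¹(X, Y) = 0`, expressed by the property that every short exact sequence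
`0 → Y → E → X → 0` splits. -/
def Ext1Vanish {R : Type} [Ring R] (X Y : ModuleCat R) : Prop :=
  ∀ (E : ModuleCat R) (i : Y ⟶ E) (p : E ⟶ X) (w : i ≫ p = 0),
    (ShortComplex.mk i p w).ShortExact → ∃ r : E ⟶ Y, i ≫ r = 𝟙 Y

section NP
variable {R : Type} [Ring R]

def SuppClosed {P : Type} [AddCommGroup P] [Module R P] (s : P →ₗ[R] (P →₀ R))
    (S : Submodule R P) : Prop := ∀ x ∈ S, ∀ y ∈ (s x).support, y ∈ S

theorem proj_quot {P : Type} [AddCommGroup P] [Module R P] (s : P →ₗ[R] (P →₀ R))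
    (hs : ∀ x, Finsupp.linearCombination R id (s x) = x) (S S' : Submodule R P)
    (h : SuppClosed s S) (h' : SuppClosed s S') :
    Module.Projective R (S' ⧸ S.submoduleOf S') := by
  classical
  let J := {y : S' // (y : P) ∉ S}
  let v : J → P := fun y => y.1
  have hv : Function.Injective v := fun a b hab => Subtype.ext (Subtype.ext hab)
  let f0 : S' →ₗ[R] (J →₀ R) := (Finsupp.lcomapDomain v hv) ∘ₗ s ∘ₗ S'.subtype
  have hf0 : S.submoduleOf S' ≤ LinearMap.ker f0 := by
    intro x hx
    rw [LinearMap.mem_ker]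
    ext j
    change s x (v j) = 0
    by_contra hne
    exact j.2 (h x hx _ (Finsupp.mem_support_iff.2 hne))
  let f := (S.submoduleOf S').liftQ f0 hf0
  let g : (J →₀ R) →ₗ[R] (S' ⧸ S.submoduleOf S') :=
    Finsupp.linearCombination R (fun j : J => Submodule.Quotient.mk j.1)
  refine Module.Projective.of_split f g ?_
  ext x
  simp only [LinearMap.comp_apply, LinearMap.id_apply, Submodule.mkQ_apply]
  change g (f0 x) = _
  have e1 : g (f0 x) = Submodule.Quotient.mk
      (Finsupp.linearCombination R (fun j : J => j.1) (f0 x)) := by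
    change _ = (S.submoduleOf S').mkQ _
    rw [Finsupp.apply_linearCombination]
    rfl
  rw [e1, Submodule.Quotient.eq]
  change ((Finsupp.linearCombination R (fun j : J => j.1) (f0 x) - x : S') : P) ∈ S
  have e2 : ((Finsupp.linearCombination R (fun j : J => j.1) (f0 x) : S') : P)
      = Finsupp.linearCombination R id ((s x).filter (fun y => y ∉ S)) := by
    change S'.subtype _ = _
    rw [Finsupp.apply_linearCombination]
    have : (s x).filter (fun y => y ∉ S) = Finsupp.mapDomain v (f0 x) := by
      change _ = Finsupp.mapDomain v (Finsupp.comapDomain v (s x) hv.injOn)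
      ext y
      by_cases hy : y ∈ Set.range v
      · obtain ⟨j, rfl⟩ := hy
        rw [Finsupp.mapDomain_apply hv, Finsupp.filter_apply_pos (fun y => y ∉ S) _ j.2]
        rfl
      · rw [Finsupp.mapDomain_of_notMem_range _ _ hy, Finsupp.filter_apply]
        by_cases hyS : y ∈ S
        · simp [hyS]
        · simp only [hyS, not_false_eq_true, if_true]
          by_contra hne
          exact hy ⟨⟨⟨y, h' x x.2 _ (Finsupp.mem_support_iff.2 hne)⟩, hyS⟩, rfl⟩
    rw [this, Finsupp.linearCombination_mapDomain]
    rfl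
  rw [Submodule.coe_sub, e2]
  have e3 : Finsupp.linearCombination R id ((s x).filter (fun y => y ∉ S)) +
      Finsupp.linearCombination R id ((s x).filter (fun y => ¬ y ∉ S)) = (x : P) := by
    rw [← map_add, Finsupp.filter_add_filter_not, hs]
  have key : ∀ A B x : P, A + B = x → B ∈ S → A - x ∈ S := by
    rintro A B _ rfl h
    rw [sub_add_cancel_left]
    exact S.neg_mem h
  refine key _ _ _ e3 ?_
  rw [Finsupp.linearCombination_apply, Finsupp.sum]
  refine S.sum_mem fun y hy => S.smul_mem _ ?_
  simp at hy
  exact hy.2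

theorem card_span_le {P : Type} [AddCommGroup P] [Module R P] {κ : Cardinal.{0}}
    (hκ : Cardinal.aleph0 ≤ κ) (hR : Cardinal.mk R ≤ κ) (A : Set P) (hA : Cardinal.mk A ≤ κ) :
    Cardinal.mk (Submodule.span R A) ≤ κ := by
  have : Function.Surjective (fun f : A →₀ R =>
      (⟨Finsupp.linearCombination R (fun a : A => (a : P)) f, by
        rw [Finsupp.mem_span_iff_linearCombination]; exact ⟨f, rfl⟩⟩ : Submodule.span R A)) := by
    rintro ⟨x, hx⟩
    obtain ⟨f, hf⟩ := (Finsupp.mem_span_iff_linearCombination R A x).1 hx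
    exact ⟨f, Subtype.ext hf⟩
  refine (Cardinal.mk_le_of_surjective this).trans ?_
  have h1 : Function.Injective (fun f : A →₀ R => (f.graph : Finset (A × R))) :=
    Finsupp.graph_injective A R
  refine (Cardinal.mk_le_of_injective h1).trans ?_
  have h2 : Cardinal.mk (A × R) ≤ κ := by
    rw [Cardinal.mk_prod, Cardinal.lift_id, Cardinal.lift_id]
    exact Cardinal.mul_le_of_le hκ hA hR
  rcases finite_or_infinite (A × R) with h | h
  · exact (Cardinal.mk_le_aleph0).trans hκ
  · rw [Cardinal.mk_finset_of_infinite]; exact h2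

structure GoodFam (P : ℕ → Type) [∀ i, AddCommGroup (P i)] [∀ i, Module R (P i)]
    (d : ∀ i, P (i+1) →ₗ[R] P i) (s : ∀ i, P i →ₗ[R] (P i →₀ R))
    (S : ∀ i, Submodule R (P i)) : Prop where
  supp : ∀ i, SuppClosed (s i) (S i)
  down : ∀ i, ∀ x ∈ S (i+1), d i x ∈ S i
  up : ∀ i, ∀ x, d i x ∈ S i → ∃ y ∈ S (i+1), d i y = d i x

def upSet {P : ℕ → Type} [∀ i, AddCommGroup (P i)] [∀ i, Module R (P i)]
    (pre : ∀ i, P i → P (i+1)) (U : ∀ i, Submodule R (P i)) : ∀ i, Set (P i)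
  | 0 => ∅
  | i+1 => pre i '' (U i)

theorem exists_small {P : ℕ → Type} [∀ i, AddCommGroup (P i)] [∀ i, Module R (P i)]
    (d : ∀ i, P (i+1) →ₗ[R] P i) (s : ∀ i, P i →ₗ[R] (P i →₀ R))
    (pre : ∀ i, P i → P (i+1)) {κ : Cardinal.{0}}
    (hκ : Cardinal.aleph0 ≤ κ) (hR : Cardinal.mk R ≤ κ) (a : P 0) :
    ∃ U : ∀ i, Submodule R (P i), a ∈ U 0 ∧ (∀ i, Cardinal.mk (U i) ≤ κ) ∧
      (∀ i, SuppClosed (s i) (U i)) ∧ (∀ i, ∀ x ∈ U (i+1), d i x ∈ U i) ∧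
      (∀ i, ∀ x ∈ U i, pre i x ∈ U (i+1)) := by
  classical
  have h1κ : (1 : Cardinal) ≤ κ := (Cardinal.one_le_aleph0).trans hκ
  let gen (U : ∀ i, Submodule R (P i)) (i : ℕ) : Set (P i) :=
    (U i : Set (P i)) ∪ ((⋃ x : U i, ((s i x).support : Set (P i))) ∪
      (d i '' (U (i+1)) ∪ upSet pre U i))
  let step (U : ∀ i, Submodule R (P i)) : ∀ i, Submodule R (P i) :=
    fun i => Submodule.span R (gen U i)
  let U0 : ∀ i, Submodule R (P i) := fun i =>
    match i with
    | 0 => Submodule.span R {a}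
    | _+1 => ⊥
  let V : ℕ → ∀ i, Submodule R (P i) := fun k => step^[k] U0
  have hVs : ∀ k i, gen (V k) i ⊆ V (k+1) i := by
    intro k i
    simp only [V, Function.iterate_succ_apply']
    exact Submodule.subset_span
  have hmono1 : ∀ i k, V k i ≤ V (k+1) i := fun i k x hx => hVs k i (Or.inl hx)
  have hmono : ∀ i, Monotone (fun k => V k i) := fun i => monotone_nat_of_le_succ (hmono1 i)
  have hcard : ∀ k i, Cardinal.mk (V k i) ≤ κ := by
    intro k
    induction k with
    | zero =>
      intro i
      cases i with
      | zero => exact card_span_le hκ hR {a} (by simpa using h1κ)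
      | succ i => change Cardinal.mk (⊥ : Submodule R (P (i+1))) ≤ κ; simpa using h1κ
    | succ k ih =>
      intro i
      simp only [V, Function.iterate_succ_apply']
      refine card_span_le hκ hR _ ?_
      have un : ∀ A B : Set (P i), Cardinal.mk A ≤ κ → Cardinal.mk B ≤ κ →
          Cardinal.mk (A ∪ B : Set (P i)) ≤ κ := fun A B hA hB =>
        (Cardinal.mk_union_le A B).trans (Cardinal.add_le_of_le hκ hA hB)
      refine un _ _ (ih i) (un _ _ ?_ (un _ _ ?_ ?_))
      · refine (Cardinal.mk_iUnion_le _).trans (Cardinal.mul_le_of_le hκ (ih i) ?_)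
        refine ciSup_le' fun x => ?_
        exact (Cardinal.mk_le_aleph0).trans hκ
      · exact Cardinal.mk_image_le.trans (ih (i+1))
      · cases i with
        | zero => change Cardinal.mk (∅ : Set (P 0)) ≤ κ; simp
        | succ i => exact (Cardinal.mk_image_le (f := pre i)).trans (ih i)
  have hmem : ∀ i x, x ∈ (⨆ k, V k i) ↔ ∃ k, x ∈ V k i := fun i x =>
    Submodule.mem_iSup_of_directed _ (hmono i).directed_le
  refine ⟨fun i => ⨆ k, V k i, ?_, ?_, ?_, ?_, ?_⟩
  · exact (hmem 0 a).2 ⟨0, Submodule.mem_span_singleton_self a⟩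
  · intro i
    have : ((⨆ k, V k i : Submodule R (P i)) : Set (P i)) = ⋃ k, (V k i : Set (P i)) := by
      ext x; simp [hmem]
    change Cardinal.mk ((⨆ k, V k i : Submodule R (P i)) : Set (P i)) ≤ κ
    rw [this]
    refine (Cardinal.mk_iUnion_le _).trans (Cardinal.mul_le_of_le hκ (by simpa using hκ) ?_)
    exact ciSup_le' fun k => hcard k i
  · intro i x hx y hy
    obtain ⟨k, hk⟩ := (hmem i x).1 hx
    exact (hmem i y).2 ⟨k+1, hVs k i (Or.inr (Or.inl (Set.mem_iUnion.2 ⟨⟨x, hk⟩, hy⟩)))⟩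
  · intro i x hx
    obtain ⟨k, hk⟩ := (hmem _ x).1 hx
    exact (hmem i _).2 ⟨k+1, hVs k i (Or.inr (Or.inr (Or.inl ⟨x, hk, rfl⟩)))⟩
  · intro i x hx
    obtain ⟨k, hk⟩ := (hmem _ x).1 hx
    exact (hmem (i+1) _).2 ⟨k+1, hVs k (i+1) (Or.inr (Or.inr (Or.inr ⟨x, hk, rfl⟩)))⟩

theorem GoodFam.extend {P : ℕ → Type} [∀ i, AddCommGroup (P i)] [∀ i, Module R (P i)]
    {d : ∀ i, P (i+1) →ₗ[R] P i} {s : ∀ i, P i →ₗ[R] (P i →₀ R)} {κ : Cardinal.{0}}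
    (hκ : Cardinal.aleph0 ≤ κ) (hR : Cardinal.mk R ≤ κ) {S : ∀ i, Submodule R (P i)}
    (hS : GoodFam P d s S) (a : P 0) :
    ∃ U : ∀ i, Submodule R (P i), a ∈ U 0 ∧ (∀ i, Cardinal.mk (U i) ≤ κ) ∧
      GoodFam P d s (fun i => S i ⊔ U i) := by
  classical
  have hpre : ∀ i, ∀ u : P i, ∃ y : P (i+1), (∃ z, u - d i z ∈ S i) → u - d i y ∈ S i := by
    intro i u
    by_cases h : ∃ z, u - d i z ∈ S i
    · exact ⟨h.choose, fun _ => h.choose_spec⟩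
    · exact ⟨0, fun h' => absurd h' h⟩
  choose pre hpre using hpre
  obtain ⟨U, ha, hc, hsupp, hd, hp⟩ := exists_small d s pre hκ hR a
  refine ⟨U, ha, hc, ?_, ?_, ?_⟩
  · intro i x hx y hy
    obtain ⟨b, hb, c, hc, rfl⟩ := Submodule.mem_sup.1 hx
    rw [map_add] at hy
    rcases Finset.mem_union.1 (Finsupp.support_add hy) with h | h
    · exact Submodule.mem_sup_left (hS.supp i b hb y h)
    · exact Submodule.mem_sup_right (hsupp i c hc y h)
  · intro i x hx
    obtain ⟨b, hb, c, hc, rfl⟩ := Submodule.mem_sup.1 hx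
    rw [map_add]
    exact Submodule.add_mem_sup (hS.down i b hb) (hd i c hc)
  · intro i x hx
    obtain ⟨b, hb, c, hc, hbc⟩ := Submodule.mem_sup.1 hx
    have h1 : c - d i (pre i c) ∈ S i := hpre i c ⟨x, by
      rw [← hbc]; simpa using hb⟩
    have h2 : d i (x - pre i c) ∈ S i := by
      rw [map_sub, ← hbc, add_sub_assoc]
      exact (S i).add_mem hb h1
    obtain ⟨y, hy, hyx⟩ := hS.up i _ h2
    exact ⟨y + pre i c, Submodule.add_mem_sup hy (hp i c hc), by rw [map_add, hyx]; simp⟩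

theorem Ext1Vanish.lin {L Y : ModuleCat.{0} R} (h : Ext1Vanish L Y) {E : Type} [AddCommGroup E]
    [Module R E] (i : Y →ₗ[R] E) (p : E →ₗ[R] L) (hi : Function.Injective i)
    (hp : Function.Surjective p) (hex : Function.Exact i p) :
    ∃ r : E →ₗ[R] Y, ∀ y, r (i y) = y := by
  have w : ModuleCat.ofHom i ≫ ModuleCat.ofHom p = 0 := by
    ext y
    exact hex.apply_apply_eq_zero y
  obtain ⟨r, hr⟩ := h (ModuleCat.of R E) (ModuleCat.ofHom i) (ModuleCat.ofHom p) w
    { exact := (ShortComplex.ShortExact.moduleCat_exact_iff_function_exact _).2 hex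
      mono_f := (ModuleCat.mono_iff_injective _).2 hi
      epi_g := (ModuleCat.epi_iff_surjective _).2 hp }
  exact ⟨r.hom, fun y => congrArg (fun f => f.hom y) hr⟩

theorem quot_projDim {n : ℕ} {X : ModuleCat.{0} R} (res : ResolutionOfLength R n X)
    (s : ∀ i, res.P i →ₗ[R] (res.P i →₀ R))
    (hs : ∀ i x, Finsupp.linearCombination R id (s i x) = x)
    (S S' : ∀ i, Submodule R (res.P i)) (hSS : ∀ i, S i ≤ S' i)
    (h : GoodFam (fun i => res.P i) (fun i => (res.d i).hom) s S)
    (h' : GoodFam (fun i => res.P i) (fun i => (res.d i).hom) s S') :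
    HasProjDimLE R n (ModuleCat.of R
      ((S' 0).map res.ε.hom ⧸ ((S 0).map res.ε.hom).submoduleOf ((S' 0).map res.ε.hom))) := by
  let D : ∀ i, (S' (i+1) ⧸ (S (i+1)).submoduleOf (S' (i+1))) →ₗ[R]
      (S' i ⧸ (S i).submoduleOf (S' i)) := fun i =>
    Submodule.mapQ _ _ ((res.d i).hom.restrict (h'.down i)) (fun x hx => h.down i x.1 hx)
  let e : (S' 0 ⧸ (S 0).submoduleOf (S' 0)) →ₗ[R]
      ((S' 0).map res.ε.hom ⧸ ((S 0).map res.ε.hom).submoduleOf ((S' 0).map res.ε.hom)) :=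
    Submodule.mapQ _ _ (res.ε.hom.restrict (fun x hx => Submodule.mem_map_of_mem hx))
      (fun x hx => Submodule.mem_map_of_mem (f := res.ε.hom) hx)
  -- the common part of the two exactness arguments
  have common : ∀ i, ∀ x (hx : x ∈ S' i), ∀ b ∈ S i, (∃ z, (res.d i).hom z = x - b) →
      (Submodule.Quotient.mk ⟨x, hx⟩ : S' i ⧸ (S i).submoduleOf (S' i)) ∈ Set.range (D i) := by
    rintro i x hx b hb ⟨z, hz⟩
    have hz' : (res.d i).hom z ∈ S' i := by
      rw [hz]; exact (S' i).sub_mem hx (hSS i hb)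
    obtain ⟨y, hy, hyz⟩ := h'.up i z hz'
    refine ⟨Submodule.Quotient.mk ⟨y, hy⟩, ?_⟩
    change Submodule.Quotient.mk _ = _
    rw [Submodule.Quotient.eq]
    change (res.d i).hom y - x ∈ S i
    rw [hyz, hz, sub_sub_cancel_left]
    exact (S i).neg_mem hb
  refine ⟨{ P := fun i => ModuleCat.of R (S' i ⧸ (S i).submoduleOf (S' i))
            d := fun i => ModuleCat.ofHom (D i)
            ε := ModuleCat.ofHom e
            surj := ?_
            exact₀ := ?_
            exact := ?_
            bounded := ?_ }, fun i => proj_quot (s i) (hs i) (S i) (S' i) (h.supp i) (h'.supp i)⟩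
  · intro t
    obtain ⟨⟨_, ⟨x, hx, rfl⟩⟩, rfl⟩ := Submodule.Quotient.mk_surjective _ t
    exact ⟨Submodule.Quotient.mk ⟨x, hx⟩, rfl⟩
  · intro q
    obtain ⟨⟨x, hx⟩, rfl⟩ := Submodule.Quotient.mk_surjective _ q
    constructor
    · intro hq
      have hq' : (Submodule.Quotient.mk (⟨res.ε.hom x, Submodule.mem_map_of_mem hx⟩ :
        (S' 0).map res.ε.hom) : (S' 0).map res.ε.hom ⧸
          ((S 0).map res.ε.hom).submoduleOf ((S' 0).map res.ε.hom)) = 0 := hq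
      rw [Submodule.Quotient.mk_eq_zero] at hq'
      obtain ⟨b, hb, hbx⟩ : res.ε.hom x ∈ (S 0).map res.ε.hom := hq'
      refine common 0 x hx b hb ((res.exact₀ (x - b)).1 ?_)
      change res.ε.hom (x - b) = 0
      rw [map_sub, hbx, sub_self]
    · rintro ⟨y, hy⟩
      rw [← hy]
      obtain ⟨⟨y, hy'⟩, rfl⟩ := Submodule.Quotient.mk_surjective _ y
      change (Submodule.Quotient.mk _ : (S' 0).map res.ε.hom ⧸
          ((S 0).map res.ε.hom).submoduleOf ((S' 0).map res.ε.hom)) = 0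
      rw [Submodule.Quotient.mk_eq_zero]
      change res.ε.hom ((res.d 0).hom y) ∈ (S 0).map res.ε.hom
      have : res.ε.hom ((res.d 0).hom y) = 0 := res.exact₀.apply_apply_eq_zero y
      rw [this]
      exact Submodule.zero_mem _
  · intro i q
    obtain ⟨⟨x, hx⟩, rfl⟩ := Submodule.Quotient.mk_surjective _ q
    constructor
    · intro hq
      have hq' : (Submodule.Quotient.mk (⟨(res.d i).hom x, h'.down i x hx⟩ :
        S' i) : S' i ⧸ (S i).submoduleOf (S' i)) = 0 := hq
      rw [Submodule.Quotient.mk_eq_zero] at hq'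
      have hq'' : (res.d i).hom x ∈ S i := hq'
      obtain ⟨b, hb, hbx⟩ := h.up i x hq''
      refine common (i+1) x hx b hb ((res.exact i (x - b)).1 ?_)
      change (res.d i).hom (x - b) = 0
      rw [map_sub]
      exact sub_eq_zero.2 hbx.symm
    · rintro ⟨y, hy⟩
      rw [← hy]
      obtain ⟨⟨y, hy'⟩, rfl⟩ := Submodule.Quotient.mk_surjective _ y
      change (Submodule.Quotient.mk _ : S' i ⧸ (S i).submoduleOf (S' i)) = 0
      rw [Submodule.Quotient.mk_eq_zero]
      change (res.d i).hom ((res.d (i+1)).hom y) ∈ S i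
      have : (res.d i).hom ((res.d (i+1)).hom y) = 0 := (res.exact i).apply_apply_eq_zero y
      rw [this]
      exact Submodule.zero_mem _
  · intro i hi
    have := res.bounded i hi
    change Subsingleton (S' i ⧸ (S i).submoduleOf (S' i))
    exact (Submodule.Quotient.mk_surjective _).subsingleton

theorem extend_complement {X E : Type} [AddCommGroup X] [Module R X] [AddCommGroup E] [Module R E]
    {Y : ModuleCat.{0} R}
    (i : Y →ₗ[R] E) (p : E →ₗ[R] X) (hi : Function.Injective i)
    (hp : Function.Surjective p) (hex : Function.Exact i p) (T T' : Submodule R X) (hT : T ≤ T')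
    (hL : Ext1Vanish (ModuleCat.of R (T' ⧸ T.submoduleOf T')) Y) (C : Submodule R E)
    (hC : ∀ y, i y ∈ C → y = 0) (hCT : C.map p = T) :
    ∃ C' : Submodule R E, C ≤ C' ∧ (∀ y, i y ∈ C' → y = 0) ∧ C'.map p = T' := by
  let E' := T'.comap p
  have hCE : ∀ c ∈ C, p c ∈ T := fun c hc => hCT ▸ Submodule.mem_map_of_mem hc
  have hiE : ∀ y, i y ∈ E' := fun y => by
    change p (i y) ∈ T'
    rw [hex.apply_apply_eq_zero]; exact T'.zero_mem
  let i' : Y →ₗ[R] (E' ⧸ C.submoduleOf E') := (C.submoduleOf E').mkQ ∘ₗ i.codRestrict E' hiE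
  let p' : (E' ⧸ C.submoduleOf E') →ₗ[R] (T' ⧸ T.submoduleOf T') :=
    Submodule.mapQ _ _ (p.restrict (fun x hx => hx)) (fun x hx => hCE x.1 hx)
  obtain ⟨r, hr⟩ := hL.lin i' p' (by
      rw [injective_iff_map_eq_zero]
      intro y hy
      exact hC y ((Submodule.Quotient.mk_eq_zero (C.submoduleOf E')).1 hy)) (by
      intro t
      obtain ⟨⟨t, ht⟩, rfl⟩ := Submodule.Quotient.mk_surjective _ t
      obtain ⟨e, rfl⟩ := hp t
      exact ⟨Submodule.Quotient.mk ⟨e, ht⟩, rfl⟩) (by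
      intro q
      obtain ⟨⟨x, hx⟩, rfl⟩ := Submodule.Quotient.mk_surjective _ q
      constructor
      · intro hq
        have hq' : p x ∈ T := (Submodule.Quotient.mk_eq_zero (T.submoduleOf T')).1 hq
        rw [← hCT] at hq'
        obtain ⟨c, hc, hcx⟩ := hq'
        obtain ⟨y, hy⟩ := (hex (x - c)).1 (by rw [map_sub, hcx, sub_self])
        refine ⟨y, (Submodule.Quotient.eq (C.submoduleOf E')).2 ?_⟩
        change i y - x ∈ C
        rw [hy, sub_sub_cancel_left]
        exact C.neg_mem hc
      · rintro ⟨y, hy⟩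
        rw [← hy]
        refine (Submodule.Quotient.mk_eq_zero (T.submoduleOf T')).2 ?_
        change p (i y) ∈ T
        rw [hex.apply_apply_eq_zero]; exact T.zero_mem)
  let ρ : E' →ₗ[R] Y := r ∘ₗ (C.submoduleOf E').mkQ
  have hρ : ∀ y, ρ ⟨i y, hiE y⟩ = y := hr
  refine ⟨(LinearMap.ker ρ).map E'.subtype, ?_, ?_, ?_⟩
  · intro c hc
    refine ⟨⟨c, hT (hCE c hc)⟩, ?_, rfl⟩
    change r (Submodule.Quotient.mk _) = 0
    rw [(Submodule.Quotient.mk_eq_zero (C.submoduleOf E')).2 hc, map_zero]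
  · rintro y ⟨e, he, hey⟩
    have : e = ⟨i y, hiE y⟩ := Subtype.ext hey
    subst this
    rw [← hρ y]; exact he
  · ext t
    constructor
    · rintro ⟨_, ⟨e, he, rfl⟩, rfl⟩
      exact e.2
    · intro ht
      obtain ⟨e, rfl⟩ := hp t
      refine ⟨e - i (ρ ⟨e, ht⟩), ⟨⟨e, ht⟩ - ⟨_, hiE (ρ ⟨e, ht⟩)⟩, ?_, rfl⟩, ?_⟩
      · rw [SetLike.mem_coe, LinearMap.mem_ker, map_sub, hρ, sub_self]
      · rw [map_sub, hex.apply_apply_eq_zero, sub_zero]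

theorem main_dir (n : ℕ) (κ : Cardinal.{0}) (hκ : Cardinal.aleph0 ≤ κ) (hκR : Cardinal.mk R ≤ κ)
    (Y : ModuleCat.{0} R)
    (H : ∀ L : ModuleCat.{0} R, HasProjDimLE R n L → Cardinal.mk L ≤ κ → Ext1Vanish L Y)
    (X : ModuleCat.{0} R) (hX : HasProjDimLE R n X) {E : Type} [AddCommGroup E] [Module R E]
    (i : Y →ₗ[R] E) (p : E →ₗ[R] X) (hi : Function.Injective i)
    (hp : Function.Surjective p) (hex : Function.Exact i p) :
    ∃ r : E →ₗ[R] Y, ∀ y, r (i y) = y := by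
  obtain ⟨res, hres⟩ := hX
  choose s hs using fun i => (hres i).out
  let Ω : Set ((∀ i, Submodule R (res.P i)) × Submodule R E) :=
    {q | GoodFam (fun i => res.P i) (fun i => (res.d i).hom) s q.1 ∧
      (∀ y, i y ∈ q.2 → y = 0) ∧ q.2.map p = (q.1 0).map res.ε.hom}
  have hz : ∃ m, Maximal (· ∈ Ω) m := by
    refine zorn_le₀ Ω ?_
    intro c hc hch
    rcases c.eq_empty_or_nonempty with rfl | hne
    · refine ⟨(fun _ => ⊥, ⊥), ⟨⟨?_, ?_, ?_⟩, ?_, ?_⟩, by simp⟩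
      · intro j x hx y hy
        rw [Submodule.mem_bot] at hx
        simp [hx] at hy
      · intro j x hx
        rw [Submodule.mem_bot] at hx
        simp [hx]
      · intro j x hx
        rw [Submodule.mem_bot] at hx
        exact ⟨0, Submodule.zero_mem _, by rw [hx, map_zero]⟩
      · intro y hy
        exact hi (by rw [map_zero]; exact hy)
      · simp
    · have : Nonempty c := hne.to_subtype
      have dir : Directed (· ≤ ·) (fun q : c => q.1) := hch.directed
      have dir1 : ∀ j, Directed (· ≤ ·) (fun q : c => q.1.1 j) := fun j a b =>
        (dir a b).imp fun _ h => ⟨h.1.1 j, h.2.1 j⟩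
      have dir2 : Directed (· ≤ ·) (fun q : c => q.1.2) := fun a b =>
        (dir a b).imp fun _ h => ⟨h.1.2, h.2.2⟩
      have mem1 : ∀ j x, x ∈ (⨆ q : c, q.1.1 j) ↔ ∃ q : c, x ∈ q.1.1 j := fun j x =>
        Submodule.mem_iSup_of_directed _ (dir1 j)
      have mem2 : ∀ x, x ∈ (⨆ q : c, q.1.2) ↔ ∃ q : c, x ∈ q.1.2 := fun x =>
        Submodule.mem_iSup_of_directed _ dir2
      refine ⟨(fun j => ⨆ q : c, q.1.1 j, ⨆ q : c, q.1.2), ⟨⟨?_, ?_, ?_⟩, ?_, ?_⟩, ?_⟩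
      · intro j x hx y hy
        obtain ⟨q, hq⟩ := (mem1 j x).1 hx
        exact (mem1 j y).2 ⟨q, (hc q.2).1.supp j x hq y hy⟩
      · intro j x hx
        obtain ⟨q, hq⟩ := (mem1 _ x).1 hx
        exact (mem1 j _).2 ⟨q, (hc q.2).1.down j x hq⟩
      · intro j x hx
        obtain ⟨q, hq⟩ := (mem1 _ _).1 hx
        obtain ⟨y, hy, hyx⟩ := (hc q.2).1.up j x hq
        exact ⟨y, (mem1 _ _).2 ⟨q, hy⟩, hyx⟩
      · intro y hy
        obtain ⟨q, hq⟩ := (mem2 _).1 hy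
        exact (hc q.2).2.1 y hq
      · simp only [Submodule.map_iSup]
        exact iSup_congr fun q => (hc q.2).2.2
      · intro q hq
        exact ⟨fun j => le_iSup (fun q : c => q.1.1 j) ⟨q, hq⟩,
          le_iSup (fun q : c => q.1.2) ⟨q, hq⟩⟩
  obtain ⟨⟨S, C⟩, ⟨hS, hC, hCT⟩, hmax⟩ := hz
  simp only at hS hC hCT
  have htop : S 0 = ⊤ := by
    rw [eq_top_iff]
    intro a _
    obtain ⟨U, haU, hcU, hU⟩ := hS.extend hκ hκR a
    have hle : ∀ j, S j ≤ S j ⊔ U j := fun j => le_sup_left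
    have hpd := quot_projDim res s hs S (fun j => S j ⊔ U j) hle hS hU
    have hcard : Cardinal.mk ((S 0 ⊔ U 0).map res.ε.hom ⧸
        ((S 0).map res.ε.hom).submoduleOf ((S 0 ⊔ U 0).map res.ε.hom)) ≤ κ := by
      refine le_trans (Cardinal.mk_le_of_surjective (f := fun u : U 0 =>
        (Submodule.Quotient.mk (⟨res.ε.hom u, Submodule.mem_map_of_mem
          (Submodule.mem_sup_right u.2)⟩ : (S 0 ⊔ U 0).map res.ε.hom) :
          (S 0 ⊔ U 0).map res.ε.hom ⧸
            ((S 0).map res.ε.hom).submoduleOf ((S 0 ⊔ U 0).map res.ε.hom))) ?_) (hcU 0)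
      intro t
      obtain ⟨⟨_, ⟨x, hx, rfl⟩⟩, rfl⟩ := Submodule.Quotient.mk_surjective _ t
      obtain ⟨b, hb, u, hu, rfl⟩ := Submodule.mem_sup.1 hx
      refine ⟨⟨u, hu⟩, ?_⟩
      rw [Submodule.Quotient.eq]
      change res.ε.hom u - res.ε.hom (b + u) ∈ (S 0).map res.ε.hom
      rw [map_add, sub_add_cancel_right]
      exact Submodule.neg_mem _ (Submodule.mem_map_of_mem hb)
    obtain ⟨C', hCC', hC', hCT'⟩ := extend_complement i p hi hp hex ((S 0).map res.ε.hom)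
      ((S 0 ⊔ U 0).map res.ε.hom) (Submodule.map_mono (hle 0)) (H _ hpd hcard) C hC hCT
    have := hmax (y := (fun j => S j ⊔ U j, C')) ⟨hU, hC', hCT'⟩ ⟨hle, hCC'⟩
    exact this.1 0 (Submodule.mem_sup_right haU)
  have hsurj : ∀ e, ∃ c ∈ C, p c = p e := by
    intro e
    obtain ⟨x, hx⟩ := res.surj (p e)
    have : p e ∈ C.map p := by
      rw [hCT, htop]; exact ⟨x, trivial, hx⟩
    exact this
  let Φ : (Y × C) →ₗ[R] E := i.coprod C.subtype
  have hΦ : Function.Bijective Φ := by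
    constructor
    · rw [injective_iff_map_eq_zero]
      rintro ⟨y, c⟩ h
      have h' : i y + c = 0 := by simpa [Φ] using h
      have hy : y = 0 := hC y (by rw [eq_neg_of_add_eq_zero_left h']; exact C.neg_mem c.2)
      subst hy
      rw [map_zero, zero_add] at h'
      exact Prod.ext rfl (Subtype.ext h')
    · intro e
      obtain ⟨c, hc, hce⟩ := hsurj e
      obtain ⟨y, hy⟩ := (hex (e - c)).1 (by rw [map_sub, hce, sub_self])
      exact ⟨(y, ⟨c, hc⟩), by simp [Φ, hy]⟩
  let Ψ := LinearEquiv.ofBijective Φ hΦ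
  refine ⟨LinearMap.fst R Y C ∘ₗ Ψ.symm.toLinearMap, fun y => ?_⟩
  have : i y = Ψ (y, 0) := by simp [Ψ, Φ]
  rw [this]
  simp

end NP

/-- The cotorsion pair `(𝒫_n, 𝒫_n^⊥)` is cogenerated by the set of `n`-projective
modules of cardinality at most `κ`, where `κ ≥ card R` is infinite: a module `Y`
satisfies `Ext¹(X, Y) = 0` for every module `X` of projective dimension at most `n` if
and only if `Ext¹(L, Y) = 0` for every module `L` of projective dimension at most `n`
with `card L ≤ κ`. -/
theorem nProjective_cotorsion_pair_cogenerated_by_smalls (R : Type) [Ring R] (n : ℕ)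
    (κ : Cardinal) (hκ : Cardinal.aleph0 ≤ κ) (hκR : Cardinal.mk R ≤ κ)
    (Y : ModuleCat R) :
    (∀ X : ModuleCat R, HasProjDimLE R n X → Ext1Vanish X Y) ↔
    (∀ L : ModuleCat R, HasProjDimLE R n L → Cardinal.mk L ≤ κ → Ext1Vanish L Y) := by
  constructor
  · intro h L hL _
    exact h L hL
  · intro H X hX E i p w hse
    have hi := (ModuleCat.mono_iff_injective _).1 hse.mono_f
    have hp := (ModuleCat.epi_iff_surjective _).1 hse.epi_g
    have hex := (ShortComplex.ShortExact.moduleCat_exact_iff_function_exact _).1 hse.exact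
    obtain ⟨r, hr⟩ := main_dir n κ hκ hκR Y H X hX i.hom p.hom hi hp hex
    refine ⟨ModuleCat.ofHom r, ?_⟩
    ext y
    exact hr y
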